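/- Let a, b > 0 and α > −1. Let f : (0,b] → (0,∞) be nondecreasing and right-continuous with Lebesgue–Stieltjes measure μ_f on (0,b], and let g : [0,b] → [0,a] be a continuous strictly increasing bijection (so g(0) = 0 and g(b) = a). Then the function f ∘ g^{-1} : (0,a] → (0,∞) is regularly varying at 0₊ with index α if and only if the following three conditions hold: (A.12) ∫_{(0,b]} g(s) dμ_f(s) < ∞; (A.13) lim_{v↓0} f(v) g(v) = 0; and (A.14) lim_{v↓0} (1/(f(v) g(v))) ∫_{(0,v]} g(s) dμ_f(s) = α/(1+α). -/

import Mathlib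

open Filter MeasureTheory

/-- A function `h : (0,a] → (0,∞)` is regularly varying at `0₊` with index `α` if
`h(λx)/h(x) → λ^α` as `x ↓ 0`, for every `λ > 0`. -/
def RegularlyVaryingAtZero (h : ℝ → ℝ) (α : ℝ) : Prop :=
  ∀ l : ℝ, 0 < l →
    Tendsto (fun x => h (l * x) / h x) (nhdsWithin 0 (Set.Ioi 0)) (nhds (l ^ α))

open Set Topology

theorem eventually_mem_Ioo_zero {r : ℝ} (hr : 0 < r) : ∀ᶠ x in 𝓝[>] (0 : ℝ), x ∈ Ioo 0 r :=
  Ioo_mem_nhdsGT hr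

theorem tendsto_const_mul_nhdsGT_zero {l : ℝ} (hl : 0 < l) :
    Tendsto (fun x : ℝ => l * x) (𝓝[>] 0) (𝓝[>] 0) := by
  refine tendsto_nhdsWithin_iff.2 ⟨?_, ?_⟩
  · exact ((continuous_const_mul l).tendsto' 0 0 (by simp)).mono_left nhdsWithin_le_nhds
  · filter_upwards [self_mem_nhdsWithin] with x hx using mul_pos hl hx

section Karamata

variable {h : ℝ → ℝ} {a : ℝ}

theorem intervalIntegrable_of_monotoneOn_of_pos (hm : MonotoneOn h (Ioc 0 a))
    (hp : ∀ x ∈ Ioc 0 a, 0 < h x) {x : ℝ} (hx : x ∈ Ioc 0 a) :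
    IntervalIntegrable h volume 0 x := by
  rw [intervalIntegrable_iff_integrableOn_Ioc_of_le hx.1.le]
  have hsub : Ioc 0 x ⊆ Ioc 0 a := Ioc_subset_Ioc_right hx.2
  refine IntegrableOn.of_bound (C := h x) (by simp)
    (aemeasurable_restrict_of_monotoneOn measurableSet_Ioc (hm.mono hsub)).aestronglyMeasurable ?_
  refine ae_restrict_of_forall_mem measurableSet_Ioc fun t ht => ?_
  rw [Real.norm_of_nonneg (hp t (hsub ht)).le]
  exact hm (hsub ht) hx ht.2

theorem integral_pos_of_monotoneOn_of_pos (hm : MonotoneOn h (Ioc 0 a))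
    (hp : ∀ x ∈ Ioc 0 a, 0 < h x) {x : ℝ} (hx : x ∈ Ioc 0 a) :
    0 < ∫ t in 0..x, h t :=
  intervalIntegral.intervalIntegral_pos_of_pos_on
    (intervalIntegrable_of_monotoneOn_of_pos hm hp hx)
    (fun t ht => hp t ⟨ht.1, ht.2.le.trans hx.2⟩) hx.1

theorem RegularlyVaryingAtZero.tendsto_integral_div {α : ℝ} (hα : -1 < α) (ha : 0 < a)
    (hm : MonotoneOn h (Ioc 0 a)) (hp : ∀ x ∈ Ioc 0 a, 0 < h x)
    (hrv : RegularlyVaryingAtZero h α) :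
    Tendsto (fun x => (∫ t in 0..x, h t) / (x * h x)) (𝓝[>] 0) (𝓝 (1 / (1 + α))) := by
  have hint : ∫ t in (0 : ℝ)..1, t ^ α = 1 / (1 + α) := by
    rw [integral_rpow (Or.inl hα), Real.one_rpow, Real.zero_rpow (by linarith), sub_zero, add_comm]
  rw [← hint]
  have hmem : ∀ {x t : ℝ}, x ∈ Ioo 0 a → t ∈ Ioc (0 : ℝ) 1 → t * x ∈ Ioc 0 a := fun hx ht =>
    ⟨mul_pos ht.1 hx.1, by nlinarith [hx.1, hx.2, ht.1, ht.2]⟩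
  have hlim : Tendsto (fun x => ∫ t in (0 : ℝ)..1, h (t * x) / h x) (𝓝[>] 0)
      (𝓝 (∫ t in (0 : ℝ)..1, t ^ α)) := by
    refine intervalIntegral.tendsto_integral_filter_of_dominated_convergence (fun _ => 1) ?_ ?_
      intervalIntegrable_const ?_
    · filter_upwards [eventually_mem_Ioo_zero ha] with x hx
      rw [uIoc_of_le zero_le_one]
      refine (aemeasurable_restrict_of_monotoneOn measurableSet_Ioc
        fun s hs t ht hst => ?_).aestronglyMeasurable
      exact div_le_div_of_nonneg_right
        (hm (hmem hx hs) (hmem hx ht) (mul_le_mul_of_nonneg_right hst hx.1.le))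
        (hp x ⟨hx.1, hx.2.le⟩).le
    · filter_upwards [eventually_mem_Ioo_zero ha] with x hx
      refine Eventually.of_forall fun t ht => ?_
      rw [uIoc_of_le zero_le_one] at ht
      have hx' : x ∈ Ioc 0 a := ⟨hx.1, hx.2.le⟩
      rw [Real.norm_of_nonneg (div_pos (hp _ (hmem hx ht)) (hp x hx')).le,
        div_le_one (hp x hx')]
      exact hm (hmem hx ht) hx' (by nlinarith [hx.1, ht.2])
    · refine Eventually.of_forall fun t ht => ?_
      rw [uIoc_of_le zero_le_one] at ht
      exact hrv t ht.1
  refine hlim.congr' ?_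
  filter_upwards [eventually_mem_Ioo_zero ha] with x hx
  rw [intervalIntegral.integral_div, intervalIntegral.integral_comp_mul_right _ hx.1.ne']
  simp only [zero_mul, one_mul, smul_eq_mul]
  rw [div_mul_eq_div_div, inv_mul_eq_div]

theorem hasDerivWithinAt_integral_Ici_of_monotoneOn (hm : MonotoneOn h (Ioc 0 a))
    (hp : ∀ x ∈ Ioc 0 a, 0 < h x) {x : ℝ} (hx : x ∈ Ioo 0 a)
    (hc : ContinuousWithinAt h (Ioi x) x) :
    HasDerivWithinAt (fun u => ∫ t in 0..u, h t) (h x) (Ici x) x := by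
  refine intervalIntegral.integral_hasDerivWithinAt_right
    (intervalIntegrable_of_monotoneOn_of_pos hm hp ⟨hx.1, hx.2.le⟩) ⟨Ioc x a, ?_, ?_⟩ hc
  · exact Ioc_mem_nhdsGT hx.2
  · exact (aemeasurable_restrict_of_monotoneOn measurableSet_Ioc
      (hm.mono (Ioc_subset_Ioc_left hx.1.le))).aestronglyMeasurable

theorem tendsto_log_integral_sub_log {β : ℝ} (ha : 0 < a)
    (hm : MonotoneOn h (Ioc 0 a)) (hp : ∀ x ∈ Ioc 0 a, 0 < h x)
    (hc : ∀ x ∈ Ioo 0 a, ContinuousWithinAt h (Ioi x) x)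
    (hρ : Tendsto (fun x => x * h x / ∫ t in 0..x, h t) (𝓝[>] 0) (𝓝 β)) {l : ℝ} (hl : 1 ≤ l) :
    Tendsto (fun x => (Real.log (∫ t in 0..l * x, h t) - β * Real.log (l * x)) -
      (Real.log (∫ t in 0..x, h t) - β * Real.log x)) (𝓝[>] 0) (𝓝 0) := by
  have hl0 : 0 < l := by linarith
  rw [Metric.tendsto_nhds]
  intro ε hε
  set δ := ε / (2 * l) with hδ
  have hδ0 : 0 < δ := by positivity
  obtain ⟨r, hr0, hr⟩ := (mem_nhdsGT_iff_exists_Ioo_subset).1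
    ((Metric.tendsto_nhds.1 hρ δ hδ0).and (eventually_mem_Ioo_zero ha))
  filter_upwards [eventually_mem_Ioo_zero (div_pos hr0 hl0)] with x hx
  have hxr : l * x < r := by
    have := (lt_div_iff₀ hl0).1 hx.2
    linarith
  have hmem : ∀ t ∈ Icc x (l * x), t ∈ Ioo 0 r := fun t ht =>
    ⟨hx.1.trans_le ht.1, ht.2.trans_lt hxr⟩
  have hderiv : ∀ t ∈ Icc x (l * x), HasDerivWithinAt
      (fun u => Real.log (∫ s in 0..u, h s) - β * Real.log u)
      (h t / (∫ s in 0..t, h s) - β * (1 / t)) (Ici t) t := by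
    intro t ht
    have hta : t ∈ Ioo 0 a := (hr (hmem t ht)).2
    have h1 := (hasDerivWithinAt_integral_Ici_of_monotoneOn hm hp hta (hc t hta)).log
      (integral_pos_of_monotoneOn_of_pos hm hp ⟨hta.1, hta.2.le⟩).ne'
    have h2 := ((hasDerivWithinAt_id t (Ici t)).log hta.1.ne').const_mul β
    exact h1.sub h2
  have hcont : ContinuousOn (fun u => Real.log (∫ s in 0..u, h s) - β * Real.log u)
      (Icc x (l * x)) := by
    have hla : l * x ∈ Ioo 0 a := (hr (hmem _ ⟨by nlinarith [hx.1], le_rfl⟩)).2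
    have hcI : ContinuousOn (fun u => ∫ s in 0..u, h s) (Icc x (l * x)) := by
      refine (intervalIntegral.continuousOn_primitive_interval'
        (intervalIntegrable_of_monotoneOn_of_pos hm hp ⟨hla.1, hla.2.le⟩) left_mem_uIcc).mono ?_
      rw [uIcc_of_le hla.1.le]
      exact Icc_subset_Icc_left hx.1.le
    refine (hcI.log fun t ht => ?_).sub
      (continuousOn_const.mul (continuousOn_id.log fun t ht => (hmem t ht).1.ne'))
    have hta := (hr (hmem t ht)).2
    exact (integral_pos_of_monotoneOn_of_pos hm hp ⟨hta.1, hta.2.le⟩).ne'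
  have hle := norm_image_sub_le_of_norm_deriv_right_le_segment (C := δ / x) hcont
    (fun t ht => hderiv t ⟨ht.1, ht.2.le⟩) ?_ (l * x) ⟨by nlinarith [hx.1], le_rfl⟩
  · rw [dist_zero_right]
    refine hle.trans_lt ?_
    have hx0 := hx.1
    have : δ / x * (l * x - x) = δ * (l - 1) := by field_simp
    rw [this]
    have : δ * l = ε / 2 := by rw [hδ]; field_simp
    nlinarith
  · intro t ht
    have ht' := hr (hmem t ⟨ht.1, ht.2.le⟩)
    have ht0 : 0 < t := ht'.2.1
    have h1 := ht'.1
    rw [Real.dist_eq] at h1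
    have : h t / (∫ s in 0..t, h s) - β * (1 / t) =
        (t * h t / (∫ s in 0..t, h s) - β) / t := by field_simp
    rw [this, Real.norm_eq_abs, abs_div, abs_of_pos ht0]
    exact div_le_div₀ hδ0.le h1.le hx.1 ht.1

theorem RegularlyVaryingAtZero.of_tendsto_integral_div {α : ℝ} (hα : -1 < α) (ha : 0 < a)
    (hm : MonotoneOn h (Ioc 0 a)) (hp : ∀ x ∈ Ioc 0 a, 0 < h x)
    (hc : ∀ x ∈ Ioo 0 a, ContinuousWithinAt h (Ioi x) x)
    (hlim : Tendsto (fun x => (∫ t in 0..x, h t) / (x * h x)) (𝓝[>] 0) (𝓝 (1 / (1 + α)))) :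
    RegularlyVaryingAtZero h α := by
  have hα0 : 0 < 1 + α := by linarith
  have hρ : Tendsto (fun x => x * h x / ∫ t in 0..x, h t) (𝓝[>] 0) (𝓝 (1 + α)) := by
    simpa using hlim.inv₀ (by positivity)
  intro l hl
  have hlog : Tendsto (fun x => (Real.log (∫ t in 0..l * x, h t) - (1 + α) * Real.log (l * x)) -
      (Real.log (∫ t in 0..x, h t) - (1 + α) * Real.log x)) (𝓝[>] 0) (𝓝 0) := by
    rcases le_total 1 l with h1 | h1
    · exact tendsto_log_integral_sub_log ha hm hp hc hρ h1
    · have := ((tendsto_log_integral_sub_log ha hm hp hc hρ ((one_le_inv₀ hl).2 h1)).comp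
        (tendsto_const_mul_nhdsGT_zero hl)).neg
      simpa [Function.comp_def, inv_mul_cancel_left₀ hl.ne'] using this
  have hfin := (((Real.continuous_exp.tendsto 0).comp hlog).mul
    ((hρ.comp (tendsto_const_mul_nhdsGT_zero hl)).div hρ hα0.ne')).mul_const (l ^ α)
  rw [Real.exp_zero, div_self hα0.ne', one_mul, one_mul] at hfin
  refine hfin.congr' ?_
  filter_upwards [eventually_mem_Ioo_zero ha,
    (tendsto_const_mul_nhdsGT_zero hl).eventually (eventually_mem_Ioo_zero ha)] with x hx hlx
  have hx0 := hx.1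
  have hI := integral_pos_of_monotoneOn_of_pos hm hp ⟨hx.1, hx.2.le⟩
  have hIl := integral_pos_of_monotoneOn_of_pos hm hp ⟨hlx.1, hlx.2.le⟩
  have hhx := hp x ⟨hx.1, hx.2.le⟩
  have hexp : Real.exp ((Real.log (∫ t in 0..l * x, h t) - (1 + α) * Real.log (l * x)) -
      (Real.log (∫ t in 0..x, h t) - (1 + α) * Real.log x)) =
      (∫ t in 0..l * x, h t) / (∫ t in 0..x, h t) / (l * l ^ α) := by
    rw [← Real.rpow_one_add' hl.le hα0.ne', Real.rpow_def_of_pos hl,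
      Real.log_mul hl.ne' hx0.ne']
    nth_rewrite 2 [← Real.exp_log hIl]
    nth_rewrite 2 [← Real.exp_log hI]
    rw [← Real.exp_sub, ← Real.exp_sub]
    congr 1
    ring
  simp only [Function.comp_apply, Pi.div_apply]
  rw [hexp]
  have := Real.rpow_pos_of_pos hl α
  field_simp

theorem regularlyVaryingAtZero_iff_tendsto_integral_div {α : ℝ} (hα : -1 < α) (ha : 0 < a)
    (hm : MonotoneOn h (Ioc 0 a)) (hp : ∀ x ∈ Ioc 0 a, 0 < h x)
    (hc : ∀ x ∈ Ioo 0 a, ContinuousWithinAt h (Ioi x) x) :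
    RegularlyVaryingAtZero h α ↔
      Tendsto (fun x => (∫ t in 0..x, h t) / (x * h x)) (𝓝[>] 0) (𝓝 (1 / (1 + α))) :=
  ⟨fun H => H.tendsto_integral_div hα ha hm hp, .of_tendsto_integral_div hα ha hm hp hc⟩

end Karamata

theorem StrictMonoOn.map_nhdsGT {g : ℝ → ℝ} {c d v : ℝ} (hg : StrictMonoOn g (Icc c d))
    (hgc : ContinuousOn g (Icc c d)) (hv : v ∈ Ico c d) : map g (𝓝[>] v) = 𝓝[>] (g v) := by
  have hvI : v ∈ Icc c d := ⟨hv.1, hv.2.le⟩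
  have hsub : ∀ {w}, w ∈ Ioc v d → Icc v w ⊆ Icc c d := fun hw => Icc_subset_Icc hv.1 hw.2
  refine le_antisymm ?_ fun s hs => ?_
  · refine tendsto_nhdsWithin_iff.2 ⟨?_, ?_⟩
    · refine ((hgc v hvI).mono_of_mem_nhdsWithin ?_).tendsto
      filter_upwards [Ioo_mem_nhdsGT hv.2] with w hw using ⟨hv.1.trans hw.1.le, hw.2.le⟩
    · filter_upwards [Ioo_mem_nhdsGT hv.2] with w hw
      exact hg hvI ⟨hv.1.trans hw.1.le, hw.2.le⟩ hw.1
  · obtain ⟨r, hr, hrs⟩ := (mem_nhdsGT_iff_exists_Ioo_subset' hv.2).1 (mem_map.1 hs)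
    have hw : min r d ∈ Ioc v d := ⟨lt_min hr hv.2, min_le_right _ _⟩
    have hwI : min r d ∈ Icc c d := hsub hw ⟨hw.1.le, le_rfl⟩
    filter_upwards [Ioo_mem_nhdsGT (hg hvI hwI hw.1)] with x hx
    obtain ⟨u, hu, rfl⟩ := intermediate_value_Icc hw.1.le (hgc.mono (hsub hw)) ⟨hx.1.le, hx.2.le⟩
    have huI := hsub hw hu
    exact hrs ⟨(hg.lt_iff_lt hvI huI).1 hx.1,
      ((hg.lt_iff_lt huI hwI).1 hx.2).trans_le (min_le_left _ _)⟩

/-- Integration by parts for the Stieltjes integral of `g` against `f = h ∘ g`, by layer cake. -/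
theorem setLIntegral_ofReal_eq_setLIntegral_sub {b : ℝ} {f g h : ℝ → ℝ} {μ : Measure ℝ}
    (hμ : ∀ x y, 0 < x → x ≤ y → y ≤ b → μ (Ioc x y) = ENNReal.ofReal (f y - f x))
    (hgc : ContinuousOn g (Icc 0 b)) (hgm : StrictMonoOn g (Icc 0 b)) (hg0 : g 0 = 0)
    (hh : ∀ x ∈ Ioc 0 b, h (g x) = f x) {v : ℝ} (hv : v ∈ Ioc 0 b) :
    ∫⁻ s in Ioc 0 v, ENNReal.ofReal (g s) ∂μ =
      ∫⁻ t in Ioc 0 (g v), ENNReal.ofReal (f v - h t) := by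
  have hsub : Icc 0 v ⊆ Icc 0 b := Icc_subset_Icc_right hv.2
  have hgI : ∀ s ∈ Ioc 0 v, 0 ≤ g s ∧ g s ≤ g v := fun s hs => by
    have hs' := hsub ⟨hs.1.le, hs.2⟩
    rw [← hg0]
    exact ⟨hgm.monotoneOn ⟨le_rfl, hv.1.le.trans hv.2⟩ hs' hs.1.le,
      hgm.monotoneOn hs' ⟨hv.1.le, hv.2⟩ hs.2⟩
  rw [lintegral_eq_lintegral_meas_lt _ (ae_restrict_of_forall_mem measurableSet_Ioc
      fun s hs => (hgI s hs).1) ((hgc.mono (Ioc_subset_Icc_self.trans hsub)).aemeasurable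
      measurableSet_Ioc)]
  rw [← lintegral_inter_add_sdiff _ (Ioi 0) (measurableSet_Iic (a := g v)), Ioi_inter_Iic,
    setLIntegral_eq_zero (measurableSet_Ioi.diff measurableSet_Iic), add_zero]
  · refine setLIntegral_congr_fun measurableSet_Ioc fun t ht => ?_
    obtain ⟨u, hu, rfl⟩ := intermediate_value_Icc hv.1.le (hgc.mono hsub)
      (show t ∈ Icc (g 0) (g v) from ⟨hg0.le.trans ht.1.le, ht.2⟩)
    have hu0 : 0 < u := hu.1.lt_of_ne (by rintro rfl; exact ht.1.ne' hg0)
    have hset : {s | g u < g s} ∩ Ioc 0 v = Ioc u v := by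
      ext s
      constructor
      · rintro ⟨hus, hs⟩
        exact ⟨(hgm.lt_iff_lt (hsub hu) (hsub ⟨hs.1.le, hs.2⟩)).1 hus, hs.2⟩
      · intro hs
        have hs0 := hu0.trans hs.1
        exact ⟨hgm (hsub hu) (hsub ⟨hs0.le, hs.2⟩) hs.1, hs0, hs.2⟩
    rw [Measure.restrict_apply' measurableSet_Ioc, hset, hμ u v hu0 hu.2 hv.2,
      hh u ⟨hu0, hu.2.trans hv.2⟩]
  · rintro t ⟨ht0, ht⟩
    have hvt : g v < t := not_le.1 ht
    change μ.restrict (Ioc 0 v) {s | t < g s} = 0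
    rw [Measure.restrict_apply' measurableSet_Ioc]
    convert measure_empty (μ := μ)
    ext s
    simp only [mem_inter_iff, mem_empty_iff_false, iff_false, not_and]
    exact fun hts hs => (hvt.trans hts).not_ge (hgI s hs).2

/-- **Corollary A.8.** Let `f : (0,b] → (0,∞)` be nondecreasing and right-continuous with
Lebesgue–Stieltjes measure `μ`, and let `g : [0,b] → [0,a]` be a continuous strictly
increasing bijection. For `α > -1`, the composition `h = f ∘ g⁻¹` is regularly varying at
`0₊` with index `α` iff (A.12) `∫_{(0,b]} g(s) dμ(s) < ∞`, (A.13) `f(v)g(v) → 0` as `v ↓ 0`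
and (A.14) `lim_{v↓0} (f(v)g(v))⁻¹ ∫_{(0,v]} g(s) dμ(s) = α/(1+α)` hold. -/
theorem stmt_12 (a b α : ℝ) (ha : 0 < a) (hb : 0 < b) (hα : -1 < α)
    (f g h : ℝ → ℝ)
    (hmono : ∀ x y, 0 < x → x ≤ y → y ≤ b → f x ≤ f y)
    (hpos : ∀ x ∈ Set.Ioc (0 : ℝ) b, 0 < f x)
    (hrc : ∀ x ∈ Set.Ioo (0 : ℝ) b, Tendsto f (nhdsWithin x (Set.Ioi x)) (nhds (f x)))
    (μ : Measure ℝ)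
    (hμ : ∀ x y, 0 < x → x ≤ y → y ≤ b → μ (Set.Ioc x y) = ENNReal.ofReal (f y - f x))
    (hgc : ContinuousOn g (Set.Icc 0 b))
    (hgm : StrictMonoOn g (Set.Icc 0 b))
    (hg0 : g 0 = 0) (hgb : g b = a)
    (hgsurj : Set.SurjOn g (Set.Icc 0 b) (Set.Icc 0 a))
    (hh : ∀ x ∈ Set.Ioc (0 : ℝ) b, h (g x) = f x) :
    RegularlyVaryingAtZero h α ↔
      ((∫⁻ s in Set.Ioc (0 : ℝ) b, ENNReal.ofReal (g s) ∂μ) < ⊤ ∧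
       Tendsto (fun v => f v * g v) (nhdsWithin 0 (Set.Ioi 0)) (nhds 0) ∧
       Tendsto (fun v => (1 / (f v * g v)) * ∫ s in Set.Ioc (0 : ℝ) v, g s ∂μ)
         (nhdsWithin 0 (Set.Ioi 0)) (nhds (α / (1 + α)))) := by
  have hα0 : 1 + α ≠ 0 := by linarith
  have hgI : ∀ v ∈ Ioc 0 b, g v ∈ Ioc 0 a := fun v hv => by
    rw [← hgb, ← hg0]
    exact ⟨hgm ⟨le_rfl, hb.le⟩ ⟨hv.1.le, hv.2⟩ hv.1,
      hgm.monotoneOn ⟨hv.1.le, hv.2⟩ ⟨hb.le, le_rfl⟩ hv.2⟩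
  have hsurj : ∀ x ∈ Ioc 0 a, ∃ v ∈ Ioc 0 b, g v = x := fun x hx => by
    obtain ⟨v, hv, rfl⟩ := hgsurj ⟨hx.1.le, hx.2⟩
    exact ⟨v, ⟨hv.1.lt_of_ne (by rintro rfl; exact hx.1.ne' hg0), hv.2⟩, rfl⟩
  have hm : MonotoneOn h (Ioc 0 a) := by
    intro x hx y hy hxy
    obtain ⟨v, hv, rfl⟩ := hsurj x hx
    obtain ⟨w, hw, rfl⟩ := hsurj y hy
    rw [hh v hv, hh w hw]
    exact hmono v w hv.1
      ((hgm.le_iff_le (Ioc_subset_Icc_self hv) (Ioc_subset_Icc_self hw)).1 hxy) hw.2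
  have hp : ∀ x ∈ Ioc 0 a, 0 < h x := by
    intro x hx
    obtain ⟨v, hv, rfl⟩ := hsurj x hx
    exact hh v hv ▸ hpos v hv
  have hc : ∀ x ∈ Ioo 0 a, ContinuousWithinAt h (Ioi x) x := by
    intro x hx
    obtain ⟨v, hv, rfl⟩ := hsurj x ⟨hx.1, hx.2.le⟩
    have hvb : v < b := hv.2.lt_of_ne (by rintro rfl; exact hx.2.ne hgb)
    rw [ContinuousWithinAt, ← hgm.map_nhdsGT hgc ⟨hv.1.le, hvb⟩, tendsto_map'_iff, hh v hv]
    refine (hrc v ⟨hv.1, hvb⟩).congr' ?_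
    filter_upwards [Ioo_mem_nhdsGT hvb] with w hw
      using (hh w ⟨hv.1.trans hw.1, hw.2.le⟩).symm
  have hmap : map g (𝓝[>] 0) = 𝓝[>] 0 := by
    simpa only [hg0] using hgm.map_nhdsGT hgc ⟨le_rfl, hb⟩
  have hint : ∀ v ∈ Ioc 0 b, IntegrableOn (fun t => f v - h t) (Ioc 0 (g v)) := fun v hv =>
    (integrable_const _).sub ((intervalIntegrable_iff_integrableOn_Ioc_of_le (hgI v hv).1.le).1
      (intervalIntegrable_of_monotoneOn_of_pos hm hp (hgI v hv)))
  have hle : ∀ v ∈ Ioc 0 b, ∀ t ∈ Ioc 0 (g v), h t ≤ f v := fun v hv t ht =>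
    hh v hv ▸ hm ⟨ht.1, ht.2.trans (hgI v hv).2⟩ (hgI v hv) ht.2
  have hparts : ∀ v ∈ Ioc 0 b,
      ∫ s in Ioc 0 v, g s ∂μ = f v * g v - ∫ t in 0..g v, h t := by
    intro v hv
    have hsub : Ioc 0 v ⊆ Ioc 0 b := Ioc_subset_Ioc_right hv.2
    rw [integral_eq_lintegral_of_nonneg_ae (ae_restrict_of_forall_mem measurableSet_Ioc
        fun s hs => (hgI s (hsub hs)).1.le) ((hgc.mono (hsub.trans
        Ioc_subset_Icc_self)).aestronglyMeasurable measurableSet_Ioc),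
      setLIntegral_ofReal_eq_setLIntegral_sub hμ hgc hgm hg0 hh hv,
      ← integral_eq_lintegral_of_nonneg_ae (ae_restrict_of_forall_mem measurableSet_Ioc
        fun t ht => sub_nonneg.2 (hle v hv t ht)) (hint v hv).aestronglyMeasurable,
      ← intervalIntegral.integral_of_le (hgI v hv).1.le,
      intervalIntegral.integral_sub intervalIntegrable_const
        (intervalIntegrable_of_monotoneOn_of_pos hm hp (hgI v hv)),
      intervalIntegral.integral_const, smul_eq_mul, sub_zero, mul_comm]
  have hfin : ∫⁻ s in Ioc 0 b, ENNReal.ofReal (g s) ∂μ < ⊤ := by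
    have hbI : b ∈ Ioc 0 b := ⟨hb, le_rfl⟩
    rw [setLIntegral_ofReal_eq_setLIntegral_sub hμ hgc hgm hg0 hh hbI]
    exact (hint b hbI).lintegral_lt_top
  have hzero : Tendsto (fun v => f v * g v) (𝓝[>] 0) (𝓝 0) := by
    have hg : Tendsto g (𝓝[>] 0) (𝓝 0) :=
      (tendsto_map.mono_right hmap.le).mono_right nhdsWithin_le_nhds
    refine squeeze_zero' ?_ ?_ (by simpa using hg.const_mul (f b))
    · filter_upwards [eventually_mem_Ioo_zero hb] with v hv
      exact (mul_pos (hpos v ⟨hv.1, hv.2.le⟩) (hgI v ⟨hv.1, hv.2.le⟩).1).le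
    · filter_upwards [eventually_mem_Ioo_zero hb] with v hv
      exact mul_le_mul_of_nonneg_right (hmono v b hv.1 hv.2.le le_rfl)
        (hgI v ⟨hv.1, hv.2.le⟩).1.le
  have heq : (fun v => (1 / (f v * g v)) * ∫ s in Ioc 0 v, g s ∂μ) =ᶠ[𝓝[>] 0]
      fun v => 1 - (∫ t in 0..g v, h t) / (g v * h (g v)) := by
    filter_upwards [eventually_mem_Ioo_zero hb] with v hv
    have hv' : v ∈ Ioc 0 b := ⟨hv.1, hv.2.le⟩
    have hf := hpos v hv'
    have hg := (hgI v hv').1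
    rw [hparts v hv', hh v hv']
    field_simp
  rw [regularlyVaryingAtZero_iff_tendsto_integral_div hα ha hm hp hc, tendsto_congr' heq]
  nth_rewrite 1 [← hmap]
  rw [tendsto_map'_iff, Function.comp_def]
  refine ⟨fun H => ⟨hfin, hzero, ?_⟩, fun H => ?_⟩
  · convert H.const_sub 1 using 2
    field_simp
    ring
  · convert H.2.2.const_sub 1 using 2
    · ring
    · field_simp
      ring
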